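/- Let k ≥ 2, a ∈ Γ_k, let u be any nontrivial radial Neumann solution of Δu + a u = 0 on B_1, and let 1 ≤ i ≤ k−1. Then u has a zero in the interval [r_{i+1}, r_i). Moreover, if u(r_{i+1}) = 0 and u has no zero in (r_{i+1}, r_i), then u(r_i) = 0 and a(r) = μ_k for a.e. r ∈ (r_{i+1}, r_i). -/

import Mathlib

open MeasureTheory Set Filter

noncomputable section

/-- The measure of the (N-1)-dimensional unit sphere in `ℝ^N`. -/
def omegaN (N : ℕ) : ℝ :=
  N * (volume (Metric.ball (0 : EuclideanSpace ℝ (Fin N)) 1)).toReal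

/-- `u` is a radial Neumann solution of `Δu + a u = 0` on the unit ball of `ℝ^N`,
with explicit derivative function `u'` : `u` is continuous on `[0,1]`, differentiable on
`(0,1]`, satisfies the integrated radial equation
`r^(N-1) u'(r) = -∫_0^r s^(N-1) a(s) u(s) ds` on `(0,1]`, and `u'(1) = 0`. -/
def IsRadialNeumannSolutionDeriv (N : ℕ) (a u u' : ℝ → ℝ) : Prop :=
  ContinuousOn u (Icc 0 1) ∧
  (∀ r ∈ Ioc (0:ℝ) 1, HasDerivAt u (u' r) r) ∧
  (∀ r ∈ Ioc (0:ℝ) 1,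
    r ^ (N - 1) * u' r = - ∫ s in (0:ℝ)..r, s ^ (N - 1) * a s * u s) ∧
  u' 1 = 0

/-- `u` is a radial Neumann solution of `Δu + a u = 0` on the unit ball of `ℝ^N`. -/
def IsRadialNeumannSolution (N : ℕ) (a u : ℝ → ℝ) : Prop :=
  ∃ u' : ℝ → ℝ, IsRadialNeumannSolutionDeriv N a u u'

/-- `u` is not identically zero on `[0,1]`. -/
def NontrivialSol (u : ℝ → ℝ) : Prop := ∃ r ∈ Icc (0:ℝ) 1, u r ≠ 0

/-- `μ ≺ a` : `a(r) ≥ μ` for a.e. `r ∈ (0,1)` and `a(r) > μ` on a set of positive measure. -/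
def Prec (μ : ℝ) (a : ℝ → ℝ) : Prop :=
  (∀ᵐ r ∂(volume.restrict (Ioo (0:ℝ) 1)), μ ≤ a r) ∧
  0 < volume {r ∈ Ioo (0:ℝ) 1 | μ < a r}

/-- A radial function `a` belongs to `L^p(B_1)` (finite `p`). -/
def RadialMemLp (N : ℕ) (p : ℝ) (a : ℝ → ℝ) : Prop :=
  IntegrableOn (fun r => r ^ (N - 1) * |a r| ^ p) (Ioo (0:ℝ) 1)

/-- A radial function `a` belongs to `L^∞(B_1)`. -/
def RadialMemLinfty (a : ℝ → ℝ) : Prop :=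
  ∃ C : ℝ, ∀ᵐ r ∂(volume.restrict (Ioo (0:ℝ) 1)), |a r| ≤ C

/-- The `L^p(B_1)` norm of a radial function (finite `p`):
`(ω_N ∫_0^1 r^(N-1) |a(r)|^p dr)^(1/p)`. -/
def radialLpNorm (N : ℕ) (p : ℝ) (a : ℝ → ℝ) : ℝ :=
  (omegaN N * ∫ r in (0:ℝ)..1, r ^ (N - 1) * |a r| ^ p) ^ (1 / p)

/-- The `L^∞(B_1)` norm of a radial function: essential supremum of `|a|` on `(0,1)`. -/
def radialLinftyNorm (a : ℝ → ℝ) : ℝ :=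
  essSup (fun r => |a r|) (volume.restrict (Ioo (0:ℝ) 1))

/-- The admissible class `Γ_k` at level `μk`: radial measurable `a` with `μk ≺ a`, such that
`Δu + a u = 0` has a nontrivial radial Neumann solution, and `a ∈ L^{N/2}(B_1)` if `N ≥ 3`,
or `a ∈ L^q(B_1)` for some `q ∈ (1,∞]` if `N = 2`. -/
def GammaSet (N : ℕ) (μk : ℝ) (a : ℝ → ℝ) : Prop :=
  Measurable a ∧ Prec μk a ∧
  (∃ u : ℝ → ℝ, IsRadialNeumannSolution N a u ∧ NontrivialSol u) ∧
  (if 3 ≤ N then RadialMemLp N ((N : ℝ) / 2) a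
   else (∃ q : ℝ, 1 < q ∧ RadialMemLp N q a) ∨ RadialMemLinfty a)

/-- The Lyapunov constant `γ_{p,k}` for finite `p`. -/
def gammaLyap (N : ℕ) (μk : ℝ) (p : ℝ) : ℝ :=
  sInf {t : ℝ | ∃ a : ℝ → ℝ, GammaSet N μk a ∧ RadialMemLp N p a ∧
    t = radialLpNorm N p (fun r => a r - μk)}

/-- The Lyapunov constant `γ_{∞,k}`. -/
def gammaLyapInfty (N : ℕ) (μk : ℝ) : ℝ :=
  sInf {t : ℝ | ∃ a : ℝ → ℝ, GammaSet N μk a ∧ RadialMemLinfty a ∧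
    t = radialLinftyNorm (fun r => a r - μk)}

/-- `(μ, φ)` is the `k`-th radial Neumann eigenpair of `-Δ` on `B_1 ⊆ ℝ^N`:
`μ ≥ 0`, `φ` is a nontrivial radial Neumann solution of `Δφ + μ φ = 0` having exactly `k`
zeros in `(0,1)`, all simple, given by `rz k < rz (k-1) < ⋯ < rz 1`. -/
def IsRadialNeumannEigenpair (N k : ℕ) (μ : ℝ) (φ : ℝ → ℝ) (rz : ℕ → ℝ) : Prop :=
  0 ≤ μ ∧
  IsRadialNeumannSolution N (fun _ => μ) φ ∧ NontrivialSol φ ∧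
  (∀ i, 1 ≤ i → i ≤ k → rz i ∈ Ioo (0:ℝ) 1) ∧
  (∀ i j, 1 ≤ i → i < j → j ≤ k → rz j < rz i) ∧
  (∀ x ∈ Ioo (0:ℝ) 1, (φ x = 0 ↔ ∃ i, 1 ≤ i ∧ i ≤ k ∧ x = rz i)) ∧
  (∀ i, 1 ≤ i → i ≤ k → ∃ d : ℝ, d ≠ 0 ∧ HasDerivAt φ d (rz i))

/-- `u` (with derivative `u'`) is a radial `H^1` solution of `Δu + a u = 0` in `B_1`:
continuous on `(0,1]`, differentiable on `(0,1)`, satisfying the integrated radial equation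
between any two radii, with finite radial `H^1` energy. -/
def IsRadialH1Solution (N : ℕ) (a u u' : ℝ → ℝ) : Prop :=
  ContinuousOn u (Ioc 0 1) ∧
  (∀ r ∈ Ioo (0:ℝ) 1, HasDerivAt u (u' r) r) ∧
  (∀ s ∈ Ioo (0:ℝ) 1, ∀ r ∈ Ioo (0:ℝ) 1, s < r →
    r ^ (N - 1) * u' r - s ^ (N - 1) * u' s
      = - ∫ t in s..r, t ^ (N - 1) * a t * u t) ∧
  IntegrableOn (fun r => r ^ (N - 1) * ((u' r) ^ 2 + (u r) ^ 2)) (Ioo (0:ℝ) 1)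

/-- The Sobolev quotient: infimum of `(∫_{B_ρ} |∇w|²) / (∫_{B_ρ} |w|^q)^{2/q}` over nontrivial
`C^1` functions `w : ℝ^N → ℝ` with compact support contained in the ball `B_ρ`. -/
def sobolevQuot (N : ℕ) (q : ℝ) (ρ : ℝ) : ℝ :=
  sInf {t : ℝ | ∃ w : EuclideanSpace ℝ (Fin N) → ℝ,
    ContDiff ℝ 1 w ∧ (∃ x, w x ≠ 0) ∧ tsupport w ⊆ Metric.ball 0 ρ ∧
    t = (∫ x in Metric.ball (0 : EuclideanSpace ℝ (Fin N)) ρ, ‖fderiv ℝ w x‖ ^ 2) /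
        (∫ x in Metric.ball (0 : EuclideanSpace ℝ (Fin N)) ρ, |w x| ^ q) ^ (2 / q)}

/-- Every `a ∈ Γ_k` is integrable on `(0,1)` against the radial weight `r^(N-1)`. -/
lemma GammaSet.intervalIntegrable {N : ℕ} {μ : ℝ} {a : ℝ → ℝ} (ha : GammaSet N μ a) :
    IntervalIntegrable (fun s => s ^ (N - 1) * a s) volume 0 1 := by
  obtain ⟨hm, -, -, h⟩ := ha
  rw [intervalIntegrable_iff_integrableOn_Ioo_of_le zero_le_one]
  have hmeas : AEStronglyMeasurable (fun s : ℝ => s ^ (N - 1) * a s)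
      (volume.restrict (Ioo 0 1)) := by fun_prop
  have hpow : IntegrableOn (fun s : ℝ => s ^ (N - 1)) (Ioo 0 1) :=
    ((continuous_pow (N - 1)).integrableOn_Icc (a := 0) (b := 1)).mono_set Ioo_subset_Icc_self
  have hLp : ∀ p : ℝ, 1 ≤ p → RadialMemLp N p a →
      IntegrableOn (fun s => s ^ (N - 1) * a s) (Ioo 0 1) := by
    intro p hp hLp
    refine (hpow.add hLp).mono' hmeas ?_
    filter_upwards [ae_restrict_mem measurableSet_Ioo] with s hs
    have h0 : (0 : ℝ) ≤ s ^ (N - 1) := pow_nonneg hs.1.le _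
    have h1 : |a s| ≤ 1 + |a s| ^ p := by
      rcases le_total |a s| 1 with h | h
      · linarith [Real.rpow_nonneg (abs_nonneg (a s)) p]
      · linarith [Real.self_le_rpow_of_one_le h hp]
    rw [Real.norm_eq_abs, abs_mul, abs_of_nonneg h0]
    simpa [mul_add] using mul_le_mul_of_nonneg_left h1 h0
  split_ifs at h with hN
  · refine hLp _ ?_ h
    have : (3 : ℝ) ≤ N := by exact_mod_cast hN
    linarith
  · rcases h with ⟨q, hq, h⟩ | ⟨C, hC⟩
    · exact hLp q hq.le h
    · refine (hpow.mul_const C).mono' hmeas ?_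
      filter_upwards [ae_restrict_mem measurableSet_Ioo, hC] with s hs hCs
      have h0 : (0 : ℝ) ≤ s ^ (N - 1) := pow_nonneg hs.1.le _
      rw [Real.norm_eq_abs, abs_mul, abs_of_nonneg h0]
      exact mul_le_mul_of_nonneg_left hCs h0

lemma IsRadialNeumannSolutionDeriv.intervalIntegrable {N : ℕ} {a u u' : ℝ → ℝ}
    (hu : IsRadialNeumannSolutionDeriv N a u u')
    (ha : IntervalIntegrable (fun s => s ^ (N - 1) * a s) volume 0 1) :
    IntervalIntegrable (fun s => s ^ (N - 1) * a s * u s) volume 0 1 :=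
  ha.mul_continuousOn (by rw [uIcc_of_le zero_le_one]; exact hu.1)

/-- The flux `r^(N-1) u'(r)` of a radial Neumann solution is absolutely continuous away from the
origin. -/
lemma IsRadialNeumannSolutionDeriv.absolutelyContinuousOnInterval_flux {N : ℕ} {a u u' : ℝ → ℝ}
    (hu : IsRadialNeumannSolutionDeriv N a u u')
    (ha : IntervalIntegrable (fun s => s ^ (N - 1) * a s) volume 0 1) :
    AbsolutelyContinuousOnInterval (fun r => -∫ s in (0:ℝ)..r, s ^ (N - 1) * a s * u s) 0 1 :=
  ((hu.intervalIntegrable ha).absolutelyContinuousOnInterval_intervalIntegral left_mem_uIcc).neg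

lemma IsRadialNeumannSolutionDeriv.absolutelyContinuousOnInterval {N : ℕ} {a u u' : ℝ → ℝ}
    (hu : IsRadialNeumannSolutionDeriv N a u u')
    (ha : IntervalIntegrable (fun s => s ^ (N - 1) * a s) volume 0 1)
    {α β : ℝ} (hα : 0 < α) (hαβ : α ≤ β) (hβ : β ≤ 1) :
    AbsolutelyContinuousOnInterval u α β ∧ ContinuousOn u' (Icc α β) := by
  have hsub : Icc α β ⊆ Ioc 0 1 := fun x hx => ⟨hα.trans_le hx.1, hx.2.trans hβ⟩
  have hcont : ContinuousOn u' (Icc α β) := by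
    have hP : ContinuousOn (fun r => -∫ s in (0:ℝ)..r, s ^ (N - 1) * a s * u s) (Icc α β) := by
      refine (hu.absolutelyContinuousOnInterval_flux ha).continuousOn.mono ?_
      rw [uIcc_of_le zero_le_one]
      exact hsub.trans Ioc_subset_Icc_self
    refine (hP.div (continuousOn_pow (N - 1)) fun x hx => ?_).congr fun x hx => ?_
    · exact (pow_pos (hsub hx).1 _).ne'
    · have := (pow_pos (hsub hx).1 (N - 1)).ne'
      rw [Pi.div_apply, ← hu.2.2.1 x (hsub hx)]
      field_simp
  refine ⟨?_, hcont⟩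
  obtain ⟨C, hC⟩ := isCompact_Icc.exists_bound_of_continuousOn hcont
  refine LipschitzOnWith.absolutelyContinuousOnInterval (K := C.toNNReal) ?_
  rw [uIcc_of_le hαβ]
  refine (convex_Icc α β).lipschitzOnWith_of_nnnorm_hasDerivWithin_le
    (fun x hx => (hu.2.1 x (hsub hx)).hasDerivWithinAt) fun x hx => ?_
  rw [← NNReal.coe_le_coe, coe_nnnorm]
  exact (hC x hx).trans (Real.le_coe_toNNReal C)

/-- Weak form of the radial equation for `u` tested against another solution `v`. -/
lemma IsRadialNeumannSolutionDeriv.integral_energy {N : ℕ} {a b u u' v v' : ℝ → ℝ}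
    (hu : IsRadialNeumannSolutionDeriv N a u u') (hv : IsRadialNeumannSolutionDeriv N b v v')
    (ha : IntervalIntegrable (fun s => s ^ (N - 1) * a s) volume 0 1)
    (hb : IntervalIntegrable (fun s => s ^ (N - 1) * b s) volume 0 1)
    {α β : ℝ} (hα : 0 < α) (hαβ : α ≤ β) (hβ : β ≤ 1) :
    ∫ s in α..β, (s ^ (N - 1) * u' s * v' s - s ^ (N - 1) * a s * u s * v s) =
      β ^ (N - 1) * u' β * v β - α ^ (N - 1) * u' α * v α := by
  have hsub : Icc α β ⊆ Ioc 0 1 := fun x hx => ⟨hα.trans_le hx.1, hx.2.trans hβ⟩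
  have hint := hu.intervalIntegrable ha
  have hP := (hu.absolutelyContinuousOnInterval_flux ha).mono (c := α) (d := β) (by
    rw [uIcc_of_le zero_le_one, uIcc_of_le hαβ]
    exact hsub.trans Ioc_subset_Icc_self)
  have key := hP.integral_deriv_mul_eq_sub
    (hv.absolutelyContinuousOnInterval hb hα hαβ hβ).1
  rw [← hu.2.2.1 α (hsub (left_mem_Icc.2 hαβ)), ← hu.2.2.1 β (hsub (right_mem_Icc.2 hαβ))] at key
  rw [← key]
  refine intervalIntegral.integral_congr_ae ?_
  filter_upwards [hint.ae_hasDerivAt_integral] with x hx hxm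
  rw [uIoc_of_le hαβ] at hxm
  have hx1 := hsub (Ioc_subset_Icc_self hxm)
  have hd := (hx (by rw [uIcc_of_le zero_le_one]; exact Ioc_subset_Icc_self hx1) 0
    left_mem_uIcc).neg
  have hd' : deriv (fun r => -∫ s in (0:ℝ)..r, s ^ (N - 1) * a s * u s) x =
      -(x ^ (N - 1) * a x * u x) := hd.deriv
  rw [hd', (hv.2.1 x hx1).deriv, ← hu.2.2.1 x hx1]
  ring

/-- Green's identity between two radial Neumann solutions. -/
lemma IsRadialNeumannSolutionDeriv.integral_sub_mul {N : ℕ} {a b u u' v v' : ℝ → ℝ}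
    (hu : IsRadialNeumannSolutionDeriv N a u u') (hv : IsRadialNeumannSolutionDeriv N b v v')
    (ha : IntervalIntegrable (fun s => s ^ (N - 1) * a s) volume 0 1)
    (hb : IntervalIntegrable (fun s => s ^ (N - 1) * b s) volume 0 1)
    {α β : ℝ} (hα : 0 < α) (hαβ : α ≤ β) (hβ : β ≤ 1) :
    IntervalIntegrable (fun s => s ^ (N - 1) * (a s - b s) * u s * v s) volume α β ∧
    ∫ s in α..β, s ^ (N - 1) * (a s - b s) * u s * v s =
      β ^ (N - 1) * (v' β * u β - u' β * v β) - α ^ (N - 1) * (v' α * u α - u' α * v α) := by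
  have hsub : uIcc α β ⊆ uIcc 0 1 := by
    rw [uIcc_of_le zero_le_one, uIcc_of_le hαβ]
    exact Icc_subset_Icc hα.le hβ
  obtain ⟨hua, hu'⟩ := hu.absolutelyContinuousOnInterval ha hα hαβ hβ
  obtain ⟨hva, hv'⟩ := hv.absolutelyContinuousOnInterval hb hα hαβ hβ
  have hia := ((hu.intervalIntegrable ha).mono_set hsub).mul_continuousOn hva.continuousOn
  have hib := ((hv.intervalIntegrable hb).mono_set hsub).mul_continuousOn hua.continuousOn
  have hd : IntervalIntegrable (fun s => s ^ (N - 1) * u' s * v' s) volume α β :=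
    ContinuousOn.intervalIntegrable (by
      rw [uIcc_of_le hαβ]
      exact ((continuousOn_pow (N - 1)).mul hu').mul hv')
  have hd2 : IntervalIntegrable (fun s => s ^ (N - 1) * v' s * u' s) volume α β :=
    hd.congr fun s _ => by ring
  have e1 := hu.integral_energy hv ha hb hα hαβ hβ
  have e2 := hv.integral_energy hu hb ha hα hαβ hβ
  have hfun : (fun s => s ^ (N - 1) * (a s - b s) * u s * v s) = fun s =>
      (s ^ (N - 1) * v' s * u' s - s ^ (N - 1) * b s * v s * u s) -
        (s ^ (N - 1) * u' s * v' s - s ^ (N - 1) * a s * u s * v s) := by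
    funext s
    ring
  rw [hfun]
  refine ⟨(hd2.sub hib).sub (hd.sub hia), ?_⟩
  rw [intervalIntegral.integral_sub (hd2.sub hib) (hd.sub hia), e1, e2]
  ring

/-- A continuous function without zeros on an open interval has constant sign there; by continuity
the sign persists weakly on the closed interval. -/
lemma exists_sign_of_ne_zero {f : ℝ → ℝ} {α β : ℝ} (hαβ : α < β) (hf : ContinuousOn f (Icc α β))
    (h0 : ∀ x ∈ Ioo α β, f x ≠ 0) :
    ∃ σ : ℝ, σ ≠ 0 ∧ (∀ x ∈ Ioo α β, 0 < σ * f x) ∧ ∀ x ∈ Icc α β, 0 ≤ σ * f x := by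
  obtain ⟨σ, hσ, hpos⟩ : ∃ σ : ℝ, σ ≠ 0 ∧ ∀ x ∈ Ioo α β, 0 < σ * f x := by
    by_cases h : ∀ x ∈ Ioo α β, 0 < f x
    · exact ⟨1, one_ne_zero, by simpa using h⟩
    · push Not at h
      obtain ⟨x, hx, hfx⟩ := h
      refine ⟨-1, by norm_num, fun y hy => ?_⟩
      by_contra! hfy
      obtain ⟨z, hz, hfz⟩ := isPreconnected_Ioo.intermediate_value hx hy
        (hf.mono Ioo_subset_Icc_self) (show (0 : ℝ) ∈ Icc (f x) (f y) from ⟨hfx, by linarith⟩)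
      exact h0 z hz hfz
  refine ⟨σ, hσ, hpos, fun x hx => ?_⟩
  rw [← closure_Ioo hαβ.ne] at hx hf
  exact closure_minimal (s := Ioo α β) (t := closure (Ioo α β) ∩ (fun x => σ * f x) ⁻¹' Ici 0)
    (fun y hy => ⟨subset_closure hy, (hpos y hy).le⟩)
    ((continuousOn_const.mul hf).preimage_isClosed_of_isClosed isClosed_closure isClosed_Ici) hx |>.2

lemma HasDerivAt.nonneg_of_nonneg_right {f : ℝ → ℝ} {d α β : ℝ} (hαβ : α < β)
    (hd : HasDerivAt f d α) (h0 : f α = 0) (hf : ∀ x ∈ Ioo α β, 0 ≤ f x) : 0 ≤ d := by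
  have ht := hasDerivWithinAt_iff_tendsto_slope' self_notMem_Ioi |>.1
    (hd.hasDerivWithinAt (s := Ioi α))
  refine ge_of_tendsto ht ?_
  filter_upwards [Ioo_mem_nhdsGT hαβ] with x hx
  rw [slope_def_field, h0, sub_zero]
  exact div_nonneg (hf x hx) (sub_pos.2 hx.1).le

lemma HasDerivAt.nonpos_of_nonneg_left {f : ℝ → ℝ} {d α β : ℝ} (hαβ : α < β)
    (hd : HasDerivAt f d β) (h0 : f β = 0) (hf : ∀ x ∈ Ioo α β, 0 ≤ f x) : d ≤ 0 := by
  have ht := hasDerivWithinAt_iff_tendsto_slope' self_notMem_Iio |>.1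
    (hd.hasDerivWithinAt (s := Iio β))
  refine le_of_tendsto ht ?_
  filter_upwards [Ioo_mem_nhdsLT hαβ] with x hx
  rw [slope_def_field, h0, sub_zero]
  exact div_nonpos_of_nonneg_of_nonpos (hf x hx) (sub_neg.2 hx.2).le

/-- Sturm comparison between consecutive simple zeros `α < β` of `v`: if `b ≤ a` and `u` has no
zero in `(α, β)`, then `u` vanishes at both endpoints and `a = b` almost everywhere between. -/
lemma IsRadialNeumannSolutionDeriv.sturm {N : ℕ} {a b u u' v v' : ℝ → ℝ}
    (hu : IsRadialNeumannSolutionDeriv N a u u') (hv : IsRadialNeumannSolutionDeriv N b v v')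
    (ha : IntervalIntegrable (fun s => s ^ (N - 1) * a s) volume 0 1)
    (hb : IntervalIntegrable (fun s => s ^ (N - 1) * b s) volume 0 1)
    (hab : ∀ᵐ r ∂(volume.restrict (Ioo (0:ℝ) 1)), b r ≤ a r)
    {α β : ℝ} (hα : 0 < α) (hαβ : α < β) (hβ : β ≤ 1)
    (hvα : v α = 0) (hvβ : v β = 0) (hv'α : v' α ≠ 0) (hv'β : v' β ≠ 0)
    (hv0 : ∀ x ∈ Ioo α β, v x ≠ 0) (hu0 : ∀ x ∈ Ioo α β, u x ≠ 0) :
    u α = 0 ∧ u β = 0 ∧ ∀ᵐ r ∂(volume.restrict (Ioo α β)), a r = b r := by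
  have hsub : Icc α β ⊆ Icc 0 1 := Icc_subset_Icc hα.le hβ
  obtain ⟨σ, hσ, hσp, hσn⟩ := exists_sign_of_ne_zero hαβ (hu.1.mono hsub) hu0
  obtain ⟨τ, hτ, hτp, -⟩ := exists_sign_of_ne_zero hαβ (hv.1.mono hsub) hv0
  have hdα : 0 < τ * v' α := lt_of_le_of_ne
    (((hv.2.1 α ⟨hα, hαβ.le.trans hβ⟩).const_mul τ).nonneg_of_nonneg_right hαβ (by simp [hvα])
      fun x hx => (hτp x hx).le) (mul_ne_zero hτ hv'α).symm
  have hdβ : τ * v' β < 0 := lt_of_le_of_ne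
    (((hv.2.1 β ⟨hα.trans hαβ, hβ⟩).const_mul τ).nonpos_of_nonneg_left hαβ (by simp [hvβ])
      fun x hx => (hτp x hx).le) (mul_ne_zero hτ hv'β)
  obtain ⟨hint, hgreen⟩ := hu.integral_sub_mul hv ha hb hα hαβ.le hβ
  have hint' := hint.const_mul (σ * τ)
  have hgreen' : ∫ s in α..β, σ * τ * (s ^ (N - 1) * (a s - b s) * u s * v s) =
      β ^ (N - 1) * (τ * v' β) * (σ * u β) - α ^ (N - 1) * (τ * v' α) * (σ * u α) := by
    rw [intervalIntegral.integral_const_mul, hgreen, hvα, hvβ]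
    ring
  have habI : ∀ᵐ r ∂(volume.restrict (Ioo α β)), b r ≤ a r :=
    ae_restrict_of_ae_restrict_of_subset (Ioo_subset_Ioo hα.le hβ) hab
  have hnonneg : 0 ≤ᵐ[volume.restrict (Ioc α β)]
      fun s => σ * τ * (s ^ (N - 1) * (a s - b s) * u s * v s) := by
    rw [← restrict_Ioo_eq_restrict_Ioc]
    filter_upwards [ae_restrict_mem measurableSet_Ioo, habI] with s hs hs'
    have h1 := mul_nonneg (mul_nonneg (mul_nonneg (pow_nonneg (hα.trans hs.1).le (N - 1))
      (sub_nonneg.2 hs')) (hσp s hs).le) (hτp s hs).le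
    calc (0 : ℝ) ≤ _ := h1
      _ = _ := by ring
  have hI : 0 ≤ ∫ s in α..β, σ * τ * (s ^ (N - 1) * (a s - b s) * u s * v s) :=
    intervalIntegral.integral_nonneg_of_ae_restrict hαβ.le (by
      rw [← restrict_Ioc_eq_restrict_Icc (μ := volume)]
      exact hnonneg)
  have hpα : 0 < α ^ (N - 1) * (τ * v' α) := mul_pos (pow_pos hα _) hdα
  have hpβ : β ^ (N - 1) * (τ * v' β) < 0 :=
    mul_neg_of_pos_of_neg (pow_pos (hα.trans hαβ) _) hdβ
  have huα := hσn α (left_mem_Icc.2 hαβ.le)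
  have huβ := hσn β (right_mem_Icc.2 hαβ.le)
  have htα := mul_nonneg hpα.le huα
  have htβ := mul_nonpos_of_nonpos_of_nonneg hpβ.le huβ
  have hzα : α ^ (N - 1) * (τ * v' α) * (σ * u α) = 0 := by linarith
  have hzβ : β ^ (N - 1) * (τ * v' β) * (σ * u β) = 0 := by linarith
  refine ⟨by simpa [hσ] using (mul_eq_zero.1 hzα).resolve_left hpα.ne',
    by simpa [hσ] using (mul_eq_zero.1 hzβ).resolve_left hpβ.ne, ?_⟩
  rw [hzα, hzβ, sub_zero, intervalIntegral.integral_eq_zero_iff_of_le_of_nonneg_ae hαβ.le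
    hnonneg hint', ← restrict_Ioo_eq_restrict_Ioc] at hgreen'
  filter_upwards [ae_restrict_mem measurableSet_Ioo, hgreen'] with s hs hs'
  have h1 := (pow_pos (hα.trans hs.1) (N - 1)).ne'
  simpa [hσ, hτ, hv0 s hs, hu0 s hs, (hα.trans hs.1).ne', sub_eq_zero] using hs'

/-- For `k ≥ 2`, `a ∈ Γ_k`, `1 ≤ i ≤ k - 1`, any nontrivial radial Neumann
solution `u` of `Δu + a u = 0` vanishes in `[r_{i+1}, r_i)`; moreover if `u(r_{i+1}) = 0`
is its only zero there, then `u(r_i) = 0` and `a ≡ μ_k` a.e. on `(r_{i+1}, r_i)`. -/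
theorem stmt6 (N k : ℕ) (hN : 2 ≤ N) (hk2 : 2 ≤ k) (μk : ℝ) (φk : ℝ → ℝ) (rz : ℕ → ℝ)
    (hek : IsRadialNeumannEigenpair N k μk φk rz)
    (a : ℝ → ℝ) (ha : GammaSet N μk a)
    (u : ℝ → ℝ) (hu : IsRadialNeumannSolution N a u) (hunt : NontrivialSol u)
    (i : ℕ) (hi1 : 1 ≤ i) (hik : i + 1 ≤ k) :
    (∃ z ∈ Ico (rz (i+1)) (rz i), u z = 0) ∧
    (u (rz (i+1)) = 0 → (∀ z ∈ Ioo (rz (i+1)) (rz i), u z ≠ 0) →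
      u (rz i) = 0 ∧ ∀ᵐ r ∂(volume.restrict (Ioo (rz (i+1)) (rz i))), a r = μk) := by
  obtain ⟨-, ⟨φ', hφ⟩, -, hmem, hlt, hzero, hsimple⟩ := hek
  obtain ⟨u', hu⟩ := hu
  have hα := hmem (i + 1) (by omega) hik
  have hβ := hmem i hi1 (by omega)
  have hαβ := hlt i (i + 1) hi1 (by omega) hik
  have hzα : φk (rz (i + 1)) = 0 := (hzero _ hα).2 ⟨i + 1, by omega, hik, rfl⟩
  have hzβ : φk (rz i) = 0 := (hzero _ hβ).2 ⟨i, hi1, by omega, rfl⟩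
  have hderiv : ∀ j, 1 ≤ j → j ≤ k → φ' (rz j) ≠ 0 := by
    intro j hj hjk
    obtain ⟨d, hd, hdφ⟩ := hsimple j hj hjk
    rwa [(hφ.2.1 _ (Ioo_subset_Ioc_self (hmem j hj hjk))).unique hdφ]
  have hφ0 : ∀ x ∈ Ioo (rz (i + 1)) (rz i), φk x ≠ 0 := by
    intro x hx h
    obtain ⟨j, hj, hjk, rfl⟩ := (hzero x ⟨hα.1.trans hx.1, hx.2.trans hβ.2⟩).1 h
    rcases lt_trichotomy j i with hji | rfl | hji
    · exact lt_asymm hx.2 (hlt j i hj hji (by omega))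
    · exact lt_irrefl _ hx.2
    · rcases (Nat.succ_le_of_lt hji).eq_or_lt with rfl | h'
      · exact lt_irrefl _ hx.1
      · exact lt_asymm hx.1 (hlt (i + 1) j (by omega) h' hjk)
  have hμ : IntervalIntegrable (fun s : ℝ => s ^ (N - 1) * μk) volume 0 1 :=
    Continuous.intervalIntegrable (by fun_prop) _ _
  have key := hu.sturm hφ ha.intervalIntegrable hμ ha.2.1.1 hα.1 hαβ hβ.2.le hzα hzβ
    (hderiv _ (by omega) hik) (hderiv i hi1 (by omega)) hφ0
  refine ⟨?_, fun _ hu0 => (key hu0).2⟩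
  by_contra! h
  exact h _ (left_mem_Ico.2 hαβ) (key fun x hx => h x (Ioo_subset_Ico_self hx)).1
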